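/- arXiv:2310.15064 — 5 statements merged into one kernel-verified Lean document; each statement's English description precedes it below -/
import Mathlib

section
/- Let k ≥ 1 and let h_k be the truncated Thue–Morse morphism. Then for every finite binary word w: if ce(w) ≥ 3 then ce(h_k(w)) = ce(w), and if ce(w) < 3 then ce(h_k(w)) ≤ 3. -/
/-- The Thue–Morse word: `tm n` is the parity of the number of 1s in the
binary representation of `n` (`true` = letter 1, `false` = letter 0). -/
def tm (n : ℕ) : Bool := ((Nat.digits 2 n).count 1) % 2 == 1

/-- The factor `t[ℓ..ℓ+k-1]` of the Thue–Morse word. -/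
def tmFactor (ℓ k : ℕ) : List Bool := (List.range k).map (fun i => tm (ℓ + i))

/-- Complement of a binary word (exchange 0 and 1 in every position). -/
def wcompl (w : List Bool) : List Bool := w.map (fun b => !b)

/-- Apply the binary morphism `0 ↦ h0, 1 ↦ h1` to the word `w`. -/
def applyMorph (h0 h1 : List Bool) (w : List Bool) : List Bool :=
  (w.map (fun b => bif b then h1 else h0)).flatten

/-- The Thue–Morse morphism μ : 0 ↦ 01, 1 ↦ 10. -/
def mu : List Bool → List Bool := applyMorph [false, true] [true, false]

/-- `p` is a period of the finite word `w`: `1 ≤ p ≤ |w|` and `w[i] = w[i+p]`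
for all `i` with `i + p < |w|`. -/
def HasPeriodW (w : List Bool) (p : ℕ) : Prop :=
  1 ≤ p ∧ p ≤ w.length ∧ ∀ i, i + p < w.length → w.getD i false = w.getD (i + p) false

/-- The smallest period of `w`. -/
noncomputable def per (w : List Bool) : ℕ := sInf {p | HasPeriodW w p}

/-- The exponent of `w`: `|w| / per(w)`. -/
noncomputable def wexp (w : List Bool) : ℝ := (w.length : ℝ) / (per w : ℝ)

/-- The critical exponent of `w`: supremum of exponents of nonempty factors of `w`. -/
noncomputable def ce (w : List Bool) : ℝ :=
  sSup {r : ℝ | ∃ x : List Bool, x ≠ [] ∧ x <:+: w ∧ r = wexp x}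

/-- A `k`-prefix: the length-`k` prefix of the Thue–Morse word, or its complement. -/
def kPrefix (k : ℕ) (s : List Bool) : Prop :=
  s = tmFactor 0 k ∨ s = wcompl (tmFactor 0 k)

/-- `v` is a finite factor of the Thue–Morse word. -/
def IsTMFactor (v : List Bool) : Prop := ∃ ℓ, v = tmFactor ℓ v.length

/-- The complementary morphism `0 ↦ h0, 1 ↦ complement of h0` is cubefree:
it maps every word of critical exponent `< 3` to a word of critical exponent `< 3`. -/
def CubefreeC (h0 : List Bool) : Prop :=
  ∀ w : List Bool, ce w < 3 → ce (applyMorph h0 (wcompl h0) w) < 3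

/-- The word `x` occurs at position `i` of the word `w`. -/
def OccursAt (x w : List Bool) (i : ℕ) : Prop :=
  i + x.length ≤ w.length ∧ (w.drop i).take x.length = x

theorem tm_two_mul (n : ℕ) : tm (2 * n) = tm n := by
  rcases Nat.eq_zero_or_pos n with rfl | hn
  · rfl
  · unfold tm
    rw [Nat.digits_def' (by norm_num) (by omega : 0 < 2 * n)]
    simp

theorem tm_two_mul_add_one (n : ℕ) : tm (2 * n + 1) = !tm n := by
  unfold tm
  rw [Nat.digits_def' (by norm_num) (by omega : 0 < 2 * n + 1)]
  have h1 : (2 * n + 1) % 2 = 1 := by omega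
  have h2 : (2 * n + 1) / 2 = n := by omega
  rw [h1, h2, List.count_cons_self]
  rcases Nat.mod_two_eq_zero_or_one (List.count 1 (Nat.digits 2 n)) with h | h
  · simp [Nat.add_mod, h]
  · simp [Nat.add_mod, h]

/-- The difference sequence of the Thue–Morse word. -/
def tmDiff (r : ℕ) : Bool := xor (tm r) (tm (r + 1))

theorem tmDiff_of_even {r : ℕ} (h : r % 2 = 0) : tmDiff r = true := by
  obtain ⟨n, rfl⟩ : ∃ n, r = 2 * n := ⟨r / 2, by omega⟩
  unfold tmDiff
  rw [tm_two_mul, tm_two_mul_add_one]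
  cases tm n <;> rfl

theorem tmDiff_two_mul_add_one (n : ℕ) : tmDiff (2 * n + 1) = !tmDiff n := by
  unfold tmDiff
  rw [show 2 * n + 1 + 1 = 2 * (n + 1) by ring, tm_two_mul, tm_two_mul_add_one]
  cases tm n <;> cases tm (n + 1) <;> rfl

theorem tmDiff_of_mod_four_eq_one {r : ℕ} (h : r % 4 = 1) : tmDiff r = false := by
  obtain ⟨n, rfl⟩ : ∃ n, r = 2 * (2 * n) + 1 := ⟨r / 4, by omega⟩
  rw [tmDiff_two_mul_add_one, tmDiff_of_even (by omega)]
  rfl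

theorem tmDiff_three : tmDiff 3 = true := by
  rw [show 3 = 2 * 1 + 1 from rfl, tmDiff_two_mul_add_one, tmDiff_of_mod_four_eq_one (by norm_num)]
  rfl

/-- A concatenation of blocks `01` and `10` has no overlap of odd period. -/
theorem not_odd_overlap {Z : ℕ → Bool} (hZ : ∀ m, Z (2 * m + 1) = !Z (2 * m)) {a p : ℕ}
    (hp : p % 2 = 1) (h : ∀ j, a ≤ j → j ≤ a + p → Z j = Z (j + p)) : False := by
  have heven : ∀ j, j % 2 = 0 → Z (j + 1) = !Z j := by
    intro j hj
    obtain ⟨n, rfl⟩ : ∃ n, j = 2 * n := ⟨j / 2, by omega⟩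
    exact hZ n
  have halt : ∀ j, a ≤ j → j < a + p → Z (j + 1) = !Z j := by
    intro j h1 h2
    rcases Nat.mod_two_eq_zero_or_one j with hj | hj
    · exact heven j hj
    · rw [h j h1 h2.le, h (j + 1) (by omega) (by omega), show j + 1 + p = j + p + 1 by ring]
      exact heven _ (by omega)
  have hpar : ∀ i, i ≤ p → Z (a + i) = xor (Z a) (decide (i % 2 = 1)) := by
    intro i
    induction i with
    | zero => simp
    | succ i ih =>
      intro hi
      rw [← add_assoc, halt _ (by omega) (by omega), ih (by omega)]
      rcases Nat.mod_two_eq_zero_or_one i with hj | hj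
      · have : (i + 1) % 2 = 1 := by omega
        simp [hj, this]
      · have : (i + 1) % 2 = 0 := by omega
        simp [hj, this]
  have h1 := hpar p le_rfl
  rw [← h a le_rfl (by omega)] at h1
  simp [hp] at h1

/-- An even period of a concatenation of blocks `01` and `10` descends to the preimage. -/
theorem exists_half_period {Z : ℕ → Bool} (hZ : ∀ m, Z (2 * m + 1) = !Z (2 * m)) {a c q : ℕ}
    (h : ∀ j, a ≤ j → j ≤ a + c * (2 * q) → Z j = Z (j + 2 * q)) :
    ∃ b, ∀ j, b ≤ j → j ≤ b + c * q → Z (2 * j) = Z (2 * (j + q)) := by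
  have hc : c * (2 * q) = 2 * (c * q) := by ring
  rw [hc] at h
  refine ⟨a / 2, fun j h1 h2 => ?_⟩
  rcases Nat.mod_two_eq_zero_or_one a with ha | ha
  · rw [h (2 * j) (by omega) (by omega), mul_add]
  · have h3 := h (2 * j + 1) (by omega) (by omega)
    rw [show 2 * j + 1 + 2 * q = 2 * (j + q) + 1 by ring, hZ, hZ] at h3
    simpa using h3

theorem tm_overlap_free {a p : ℕ} (hp : 1 ≤ p)
    (h : ∀ j, a ≤ j → j ≤ a + p → tm j = tm (j + p)) : False := by
  have hZ : ∀ m, tm (2 * m + 1) = !tm (2 * m) := fun m => by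
    rw [tm_two_mul, tm_two_mul_add_one]
  induction p using Nat.strong_induction_on generalizing a with
  | _ p ih =>
    rcases Nat.mod_two_eq_zero_or_one p with h2 | h2
    · obtain ⟨q, rfl⟩ : ∃ q, p = 2 * q := ⟨p / 2, by omega⟩
      obtain ⟨b, hb⟩ := exists_half_period (c := 1) hZ (by simpa using h)
      simp only [tm_two_mul, one_mul] at hb
      exact ih q (by omega) (by omega) hb
    · exact not_odd_overlap hZ h2 h

/-- The image of the infinite word `Y` under the truncated Thue–Morse morphism of length `k`. -/
def tmImage (k : ℕ) (Y : ℕ → Bool) (j : ℕ) : Bool := xor (Y (j / k)) (tm (j % k))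

theorem tmImage_mul_add {k : ℕ} (Y : ℕ → Bool) (q : ℕ) {r : ℕ} (hr : r < k) :
    tmImage k Y (k * q + r) = xor (Y q) (tm r) := by
  unfold tmImage
  rw [Nat.mul_add_div (by omega), Nat.div_eq_of_lt hr, Nat.mul_add_mod, Nat.mod_eq_of_lt hr,
    add_zero]

theorem tmImage_two_mul_add_one (k : ℕ) (Y : ℕ → Bool) (hk : 1 ≤ k) (m : ℕ) :
    tmImage (2 * k) Y (2 * m + 1) = !tmImage (2 * k) Y (2 * m) := by
  have h1 : (2 * m + 1) / (2 * k) = 2 * m / (2 * k) := by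
    rw [← Nat.div_div_eq_div_mul, ← Nat.div_div_eq_div_mul]
    congr 1
    omega
  have h2 : (2 * m + 1) % (2 * k) = 2 * (m % k) + 1 := by
    rw [← Nat.mul_mod_mul_left, Nat.add_mod, Nat.mod_eq_of_lt (a := 1) (by omega)]
    refine Nat.mod_eq_of_lt ?_
    rw [Nat.mul_mod_mul_left]
    have := Nat.mod_lt m hk
    omega
  unfold tmImage
  rw [h1, h2, tm_two_mul_add_one, Nat.mul_mod_mul_left, tm_two_mul]
  simp

theorem tmImage_two_mul (k : ℕ) (Y : ℕ → Bool) (m : ℕ) :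
    tmImage (2 * k) Y (2 * m) = tmImage k Y m := by
  unfold tmImage
  rw [Nat.mul_div_mul_left _ _ (by norm_num), Nat.mul_mod_mul_left, tm_two_mul]

theorem tmImage_xor_succ {k : ℕ} (Y : ℕ → Bool) {j q r : ℕ} (hj : j = k * q + r)
    (hr : r + 1 < k) : xor (tmImage k Y j) (tmImage k Y (j + 1)) = tmDiff r := by
  subst hj
  rw [add_assoc, tmImage_mul_add Y q hr, tmImage_mul_add Y q (by omega)]
  unfold tmDiff
  cases Y q <;> simp

/-- For odd `k`, the period of a power of exponent greater than three that is at least `k / 2`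
is a multiple of `k`. -/
theorem dvd_period_of_odd_of_le {k a p : ℕ} (hk : k % 2 = 1) (hkp : k ≤ 2 * p) (Y : ℕ → Bool)
    (h : ∀ j, a ≤ j → j ≤ a + 2 * p → tmImage k Y j = tmImage k Y (j + p)) : k ∣ p := by
  by_contra hdvd
  have hc0 : p % k ≠ 0 := fun h0 => hdvd (Nat.dvd_of_mod_eq_zero h0)
  have hck : p % k < k := Nat.mod_lt _ (by omega)
  have hp : p = k * (p / k) + p % k := (Nat.div_add_mod p k).symm
  set c := p % k with hc
  have hpos : ∀ r, r < k → ∃ q, a ≤ k * q + r ∧ k * q + r < a + 2 * p := by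
    intro r hr
    have h1 := Nat.div_add_mod a k
    have h2 := Nat.mod_lt a (show 0 < k by omega)
    by_cases h3 : a % k ≤ r
    · exact ⟨a / k, by omega, by omega⟩
    · exact ⟨a / k + 1, by rw [mul_add]; omega, by rw [mul_add]; omega⟩
  have key : ∀ r s, r + 1 < k → s + 1 < k → (s = r + c ∨ s + k = r + c) →
      tmDiff r = tmDiff s := by
    intro r s hr hs hrs
    obtain ⟨q, h1, h2⟩ := hpos r (by omega)
    rw [← tmImage_xor_succ Y (q := q) rfl hr, h (k * q + r) h1 h2.le,
      h (k * q + r + 1) (by omega) (by omega), show k * q + r + 1 + p = k * q + r + p + 1 by ring]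
    rcases hrs with e | e
    · exact tmImage_xor_succ Y (q := q + p / k) (by rw [mul_add]; omega) hs
    · exact tmImage_xor_succ Y (q := q + p / k + 1) (by rw [mul_add, mul_add]; omega) hs
  have t0 : tmDiff 0 = true := tmDiff_of_even rfl
  have t1 : tmDiff 1 = false := tmDiff_of_mod_four_eq_one rfl
  have t3 := tmDiff_three
  rcases (by omega : k = 3 ∨ 5 ≤ k) with hk3 | hk5
  · rcases (by omega : c = 1 ∨ c = 2) with h1 | h1
    · have := key 0 1 (by omega) (by omega) (by omega)
      simp [t0, t1] at this
    · have := key 1 0 (by omega) (by omega) (by omega)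
      simp [t0, t1] at this
  · rcases (by omega : (c % 2 = 1 ∧ c + 3 ≤ k) ∨ c + 2 = k ∨ c = 2 ∨ (c % 2 = 0 ∧ 4 ≤ c))
      with ⟨h1, h2⟩ | h1 | h1 | ⟨h1, h2⟩
    · have := key 1 (1 + c) (by omega) (by omega) (by omega)
      rw [t1, tmDiff_of_even (by omega)] at this
      simp at this
    · have := key 3 1 (by omega) (by omega) (by omega)
      simp [t1, t3] at this
    · have := key 1 3 (by omega) (by omega) (by omega)
      simp [t1, t3] at this
    · have := key (1 + (k - c)) 1 (by omega) (by omega) (by omega)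
      rw [t1, tmDiff_of_even (by omega)] at this
      simp at this

/-- For odd `k`, there is no power of exponent greater than three whose period is less than
`k / 2`. -/
theorem not_short_period_of_odd {k a p : ℕ} (hk : k % 2 = 1) (hp : 1 ≤ p) (hkp : 2 * p < k)
    (Y : ℕ → Bool)
    (h : ∀ j, a ≤ j → j ≤ a + 2 * p → tmImage k Y j = tmImage k Y (j + p)) : False := by
  have hdiff : ∀ j, a ≤ j → j < a + 2 * p → ∀ q r q' r', j = k * q + r → r + 1 < k →
      j + p = k * q' + r' → r' + 1 < k → tmDiff r = tmDiff r' := by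
    intro j h1 h2 q r q' r' e1 hr e2 hr'
    rw [← tmImage_xor_succ Y e1 hr, ← tmImage_xor_succ Y e2 hr', h j h1 h2.le,
      h (j + 1) (by omega) (by omega), show j + 1 + p = j + p + 1 by ring]
  have hmem : ∀ q r, a ≤ k * q + r → k * q + r ≤ a + 2 * p → r + p < k → tm r = tm (r + p) := by
    intro q r h1 h2 hr
    have h3 := h _ h1 h2
    rw [add_assoc, tmImage_mul_add Y q hr, tmImage_mul_add Y q (by omega)] at h3
    simpa using h3
  have hdm := Nat.div_add_mod a k
  have hs := Nat.mod_lt a (show 0 < k by omega)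
  set Q := a / k
  have hb : k * (Q + 1) = k * Q + k := by ring
  set s := a % k
  have htm_left : ∀ r, s ≤ r → r ≤ s + 2 * p → r + p < k → tm r = tm (r + p) := fun r h1 h2 h3 =>
    hmem Q r (by omega) (by omega) h3
  have htm_right : ∀ r, k + r ≤ s + 2 * p → r + p < k → tm r = tm (r + p) := fun r h1 h2 =>
    hmem (Q + 1) r (by omega) (by omega) h2
  have hdiff_left : ∀ r, s ≤ r → r < s + 2 * p → r + p + 1 < k → tmDiff r = tmDiff (r + p) :=
    fun r h1 h2 h3 => hdiff (k * Q + r) (by omega) (by omega) Q r Q (r + p) rfl (by omega)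
      (by omega) h3
  have hdiff_right : ∀ r, k + r < s + 2 * p → r + p + 1 < k → tmDiff r = tmDiff (r + p) :=
    fun r h1 h2 => hdiff (k * (Q + 1) + r) (by omega) (by omega) (Q + 1) r (Q + 1) (r + p) rfl
      (by omega) (by omega) h2
  have hdiff_cross : ∀ r r', s ≤ r → r < s + 2 * p → r + 1 < k → r + p = k + r' → r' + 1 < k →
      tmDiff r = tmDiff r' := fun r r' h1 h2 h3 h4 h5 =>
    hdiff (k * Q + r) (by omega) (by omega) Q r (Q + 1) r' rfl h3 (by omega) h5
  have t1 : tmDiff 1 = false := tmDiff_of_mod_four_eq_one rfl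
  by_cases hL : s + 2 * p < k
  · exact tm_overlap_free (a := s) hp fun j h1 h2 => htm_left j h1 (by omega) (by omega)
  by_cases hR : k ≤ s + p
  · exact tm_overlap_free (a := 0) hp fun j h1 h2 => htm_right j (by omega) (by omega)
  rcases (by omega : p = 1 ∨ p = 2 ∨ (4 ≤ p ∧ p % 2 = 0) ∨ (3 ≤ p ∧ p % 2 = 1))
    with rfl | rfl | ⟨h1, h2⟩ | ⟨h1, h2⟩
  · exact absurd (htm_right 0 (by omega) (by omega)) (by simp [tm])
  · exact absurd (htm_right 0 (by omega) (by omega)) (by simp [tm])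
  · have := hdiff_cross (k + 1 - p) 1 (by omega) (by omega) (by omega) (by omega) (by omega)
    rw [t1, tmDiff_of_even (by omega)] at this
    simp at this
  · by_cases h3 : k + 1 < s + 2 * p
    · have := hdiff_right 1 h3 (by omega)
      rw [t1, tmDiff_of_even (by omega)] at this
      simp at this
    · have e1 := hdiff_left (k - 2 - p) (by omega) (by omega) (by omega)
      rw [tmDiff_of_even (by omega), show k - 2 - p + p = k - 2 by omega] at e1
      have n1 : (k - 2) % 4 ≠ 1 := fun e => by simp [tmDiff_of_mod_four_eq_one e] at e1
      by_cases h4 : p = 3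
      · have := hdiff_cross (k - 2) 1 (by omega) (by omega) (by omega) (by omega) (by omega)
        simp [← e1, t1] at this
      · have e2 := hdiff_left (k - 4 - p) (by omega) (by omega) (by omega)
        rw [tmDiff_of_even (by omega), show k - 4 - p + p = k - 4 by omega] at e2
        have n2 : (k - 4) % 4 ≠ 1 := fun e => by simp [tmDiff_of_mod_four_eq_one e] at e2
        omega

/-- In the image of a word under the truncated Thue–Morse morphism of length `k`, the period of
a power of exponent greater than three is a multiple of `k`. -/
theorem dvd_period_tmImage {k a p : ℕ} (hk : 1 ≤ k) (hp : 1 ≤ p) (Y : ℕ → Bool)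
    (h : ∀ j, a ≤ j → j ≤ a + 2 * p → tmImage k Y j = tmImage k Y (j + p)) : k ∣ p := by
  induction k using Nat.strong_induction_on generalizing a p with
  | _ k ih =>
    rcases Nat.mod_two_eq_zero_or_one k with hk2 | hk2
    · obtain ⟨m, rfl⟩ : ∃ m, k = 2 * m := ⟨k / 2, by omega⟩
      have hZ := tmImage_two_mul_add_one m Y (by omega)
      rcases Nat.mod_two_eq_zero_or_one p with hp2 | hp2
      · obtain ⟨q, rfl⟩ : ∃ q, p = 2 * q := ⟨p / 2, by omega⟩
        obtain ⟨b, hb⟩ := exists_half_period hZ h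
        simp only [tmImage_two_mul] at hb
        exact Nat.mul_dvd_mul_left 2 (ih m (by omega) (by omega) (by omega) hb)
      · exact (not_odd_overlap hZ hp2 fun j h1 h2 => h j h1 (by omega)).elim
    · by_cases hkp : k ≤ 2 * p
      · exact dvd_period_of_odd_of_le hk2 hkp Y h
      · exact (not_short_period_of_odd hk2 hp (by omega) Y h).elim

theorem length_applyMorph_wcompl (h w : List Bool) :
    (applyMorph h (wcompl h) w).length = h.length * w.length := by
  unfold applyMorph
  induction w with
  | nil => simp
  | cons b w ih =>
    simp only [List.map_cons, List.flatten_cons, List.length_append, ih, List.length_cons]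
    cases b <;> simp [wcompl] <;> ring

theorem getD_applyMorph_wcompl (h w : List Bool) {j : ℕ} (hj : j < h.length * w.length) :
    (applyMorph h (wcompl h) w).getD j false =
      xor (w.getD (j / h.length) false) (h.getD (j % h.length) false) := by
  induction w generalizing j with
  | nil => simp at hj
  | cons b w ih =>
    have hl : (bif b then wcompl h else h).length = h.length := by
      cases b <;> simp [wcompl]
    have hcons : applyMorph h (wcompl h) (b :: w) =
        (bif b then wcompl h else h) ++ applyMorph h (wcompl h) w := rfl
    have h0 : 0 < h.length := by
      by_contra h0
      simp [Nat.eq_zero_of_not_pos h0] at hj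
    rw [hcons]
    by_cases hjl : j < h.length
    · rw [List.getD_append _ _ _ _ (by omega), Nat.div_eq_of_lt hjl, Nat.mod_eq_of_lt hjl]
      cases b <;> simp [wcompl, hjl]
    · rw [List.getD_append_right _ _ _ _ (by omega), hl, ih]
      · obtain ⟨i, rfl⟩ := Nat.exists_eq_add_of_le (not_lt.mp hjl)
        rw [Nat.add_sub_cancel_left, Nat.add_div_left _ h0, Nat.add_mod_left, List.getD_cons_succ]
      · rw [List.length_cons, mul_add] at hj
        omega

theorem getD_tmFactor {k r : ℕ} (hr : r < k) : (tmFactor 0 k).getD r false = tm r := by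
  simp [tmFactor, hr]

theorem length_tmFactor (l k : ℕ) : (tmFactor l k).length = k := by
  simp [tmFactor]

theorem hasPeriodW_per {x : List Bool} (hx : x ≠ []) : HasPeriodW x (per x) :=
  Nat.sInf_mem (s := {p | HasPeriodW x p})
    ⟨x.length, List.length_pos_iff.mpr hx, le_rfl, fun i hi => by omega⟩

theorem HasPeriodW.div_le_wexp {x : List Bool} {p : ℕ} (h : HasPeriodW x p) :
    (x.length : ℝ) / p ≤ wexp x := by
  have h1 : per x ≤ p := Nat.sInf_le h
  have h2 : 1 ≤ per x := (Nat.sInf_mem (s := {p | HasPeriodW x p}) ⟨p, h⟩).1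
  unfold wexp
  gcongr

theorem wexp_nonneg (x : List Bool) : 0 ≤ wexp x := by
  unfold wexp
  positivity

theorem ce_nonneg (w : List Bool) : 0 ≤ ce w :=
  Real.sSup_nonneg (by rintro _ ⟨x, -, -, rfl⟩; exact wexp_nonneg x)

theorem wexp_le_ce {x w : List Bool} (hx : x ≠ []) (h : x <:+: w) : wexp x ≤ ce w := by
  refine le_csSup ⟨w.length, ?_⟩ ⟨x, hx, h, rfl⟩
  rintro _ ⟨y, hy, hyw, rfl⟩
  have h1 : (1 : ℝ) ≤ per y := by exact_mod_cast (hasPeriodW_per hy).1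
  have h2 : (y.length : ℝ) ≤ w.length := by exact_mod_cast hyw.length_le
  exact (div_le_self (by positivity) h1).trans h2

theorem ce_le {w : List Bool} {c : ℝ} (hc : 0 ≤ c)
    (h : ∀ x, x ≠ [] → x <:+: w → wexp x ≤ c) : ce w ≤ c :=
  Real.sSup_le (by rintro _ ⟨x, hx, hxw, rfl⟩; exact h x hx hxw) hc

theorem applyMorph_append (h0 h1 u v : List Bool) :
    applyMorph h0 h1 (u ++ v) = applyMorph h0 h1 u ++ applyMorph h0 h1 v := by
  simp [applyMorph]

theorem applyMorph_isInfix {u v : List Bool} (h : u <:+: v) (h0 h1 : List Bool) :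
    applyMorph h0 h1 u <:+: applyMorph h0 h1 v := by
  obtain ⟨s, t, rfl⟩ := h
  exact ⟨applyMorph h0 h1 s, applyMorph h0 h1 t, by simp [applyMorph_append]⟩

theorem HasPeriodW.applyMorph_wcompl {x : List Bool} {p : ℕ} (hx : HasPeriodW x p)
    {h : List Bool} (hh : h ≠ []) :
    HasPeriodW (applyMorph h (wcompl h) x) (h.length * p) := by
  have h0 : 0 < h.length := List.length_pos_iff.mpr hh
  obtain ⟨h1, h2, h3⟩ := hx
  rw [HasPeriodW, length_applyMorph_wcompl]
  refine ⟨Nat.mul_pos h0 h1, Nat.mul_le_mul_left _ h2, fun i hi => ?_⟩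
  rw [getD_applyMorph_wcompl h x (by omega), getD_applyMorph_wcompl h x hi,
    Nat.add_mul_div_left _ _ h0, Nat.add_mul_mod_self_left, h3]
  rw [← Nat.add_mul_div_left _ _ h0]
  exact Nat.div_lt_of_lt_mul hi

theorem ce_le_ce_applyMorph_wcompl {h : List Bool} (hh : h ≠ []) (w : List Bool) :
    ce w ≤ ce (applyMorph h (wcompl h) w) := by
  refine ce_le (ce_nonneg _) fun x hx hxw => ?_
  have h0 : (h.length : ℝ) ≠ 0 := by simpa using hh
  have hper := (hasPeriodW_per hx).applyMorph_wcompl hh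
  calc wexp x = ((applyMorph h (wcompl h) x).length : ℝ) / (h.length * per x : ℕ) := by
        rw [length_applyMorph_wcompl]
        push_cast
        rw [mul_div_mul_left _ _ h0, wexp]
    _ ≤ wexp (applyMorph h (wcompl h) x) := hper.div_le_wexp
    _ ≤ _ := by
        refine wexp_le_ce (fun e => ?_) (applyMorph_isInfix hxw _ _)
        have := hper.1.trans hper.2.1
        simp [e] at this

theorem ce_applyMorph_tmFactor_le {k : ℕ} (hk : 1 ≤ k) (w : List Bool) :
    ce (applyMorph (tmFactor 0 k) (wcompl (tmFactor 0 k)) w) ≤ max 3 (ce w) := by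
  refine ce_le (by positivity) fun x hx hxw => ?_
  by_contra! hlt
  obtain ⟨h3, hce⟩ := max_lt_iff.mp hlt
  obtain ⟨hp1, hpn, hper⟩ := hasPeriodW_per hx
  rw [wexp] at h3 hce
  set p := per x
  have hp0 : (0 : ℝ) < p := by exact_mod_cast hp1
  rw [lt_div_iff₀ hp0] at h3
  have hlen : 3 * p < x.length := by exact_mod_cast h3
  obtain ⟨u, v, huv⟩ := hxw
  have htot : u.length + x.length + v.length = k * w.length := by
    rw [← length_tmFactor 0 k, ← length_applyMorph_wcompl, ← huv]
    simp [add_assoc]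
  set a := u.length
  set n := x.length
  set Y : ℕ → Bool := fun i => w.getD i false with hY
  have hX : ∀ i, i < n → x.getD i false = tmImage k Y (a + i) := by
    intro i hi
    have hlt : a + i < (tmFactor 0 k).length * w.length := by
      rw [length_tmFactor]
      omega
    have := getD_applyMorph_wcompl _ w hlt
    rw [← huv, length_tmFactor, getD_tmFactor (Nat.mod_lt _ hk),
      List.getD_append _ _ _ _ (by simp; omega), List.getD_append_right _ _ _ _ (by omega),
      Nat.add_sub_cancel_left] at this
    exact this
  have hXp : ∀ j, a ≤ j → j + p < a + n → tmImage k Y j = tmImage k Y (j + p) := by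
    intro j h1 h2
    obtain ⟨i, rfl⟩ := Nat.exists_eq_add_of_le h1
    rw [add_assoc, ← hX i (by omega), ← hX (i + p) (by omega)]
    exact hper i (by omega)
  obtain ⟨q, hq⟩ := dvd_period_tmImage hk hp1 Y fun j h1 h2 => hXp j h1 (by omega)
  have hq1 : 1 ≤ q := by
    by_contra hq0
    simp [show q = 0 by omega] at hq
    omega
  have hYq : ∀ i, a / k ≤ i → i ≤ (a + n - p - 1) / k → Y i = Y (i + q) := by
    intro i h1 h2
    have h4 := (Nat.le_div_iff_mul_le hk).mp h2
    have h5 := (Nat.div_lt_iff_lt_mul hk).mp (Nat.lt_succ_of_le h1)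
    rw [mul_comm, Nat.mul_succ] at h5
    rw [mul_comm] at h4
    have h6 : ∀ r, r < k → a ≤ k * i + r → k * i + r + p < a + n → Y i = Y (i + q) := by
      intro r hr h7 h8
      have h9 := hXp _ h7 h8
      rw [show k * i + r + p = k * (i + q) + r by rw [hq]; ring, tmImage_mul_add Y _ hr,
        tmImage_mul_add Y _ hr] at h9
      simpa using h9
    by_cases h7 : a ≤ k * i
    · exact h6 0 hk h7 (by omega)
    · exact h6 (a - k * i) (by omega) (by omega) (by omega)
  set A := a / k
  set B := (a + n - p - 1) / k
  have hAB : A ≤ B := Nat.div_le_div_right (by omega)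
  have hA : k * A ≤ a := Nat.mul_div_le a k
  have hB : a + n - p - 1 < k * (B + 1) := Nat.lt_mul_div_succ _ hk
  have hB' : k * B ≤ a + n - p - 1 := Nat.mul_div_le _ k
  have hBq : B + q < w.length := by
    refine Nat.lt_of_mul_lt_mul_left (a := k) ?_
    rw [mul_add, ← hq]
    omega
  obtain ⟨d, hd⟩ := Nat.exists_eq_add_of_le hAB
  have hylen : ((w.drop A).take (d + 1 + q)).length = d + 1 + q := by
    simp
    omega
  have hget : ∀ i, i < d + 1 + q → ((w.drop A).take (d + 1 + q)).getD i false = Y (A + i) := by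
    intro i hi
    simp [hY, List.getD_eq_getElem?_getD, hi]
  have hyper : HasPeriodW ((w.drop A).take (d + 1 + q)) q := by
    rw [HasPeriodW, hylen]
    refine ⟨hq1, by omega, fun i hi => ?_⟩
    rw [hget i (by omega), hget (i + q) hi, ← add_assoc]
    exact hYq _ (by omega) (by omega)
  have hle := hyper.div_le_wexp.trans (wexp_le_ce (w := w) (by
    intro e
    rw [e] at hylen
    simp only [List.length_nil] at hylen
    omega) ((List.take_prefix _ _).isInfix.trans (List.drop_suffix _ _).isInfix))
  refine absurd hce (not_lt.mpr (le_trans ?_ hle))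
  have hq0 : (0 : ℝ) < q := by exact_mod_cast hq1
  rw [hylen, div_le_div_iff₀ hp0 hq0]
  have hn : n ≤ k * (d + 1 + q) := by
    have e1 : k * (B + 1) = k * A + k * (d + 1) := by rw [hd]; ring
    rw [mul_add, ← hq]
    omega
  have : n * q ≤ (d + 1 + q) * p := by
    rw [hq]
    calc n * q ≤ k * (d + 1 + q) * q := Nat.mul_le_mul_right _ hn
      _ = _ := by ring
  exact_mod_cast this

/-- for `k ≥ 1` and the truncated Thue–Morse morphism `h_k`
(`0 ↦ t[0..k-1]`, `1 ↦` its complement), for every finite binary word `w`: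
if `ce(w) ≥ 3` then `ce(h_k(w)) = ce(w)`, and if `ce(w) < 3` then `ce(h_k(w)) ≤ 3`. -/
theorem stmt0 (k : ℕ) (hk : 1 ≤ k) (w : List Bool) :
    ((3 : ℝ) ≤ ce w →
      ce (applyMorph (tmFactor 0 k) (wcompl (tmFactor 0 k)) w) = ce w) ∧
    (ce w < (3 : ℝ) →
      ce (applyMorph (tmFactor 0 k) (wcompl (tmFactor 0 k)) w) ≤ 3) := by
  have hne : tmFactor 0 k ≠ [] := by
    rw [← List.length_pos_iff, length_tmFactor]
    exact hk
  have hle := ce_applyMorph_tmFactor_le hk w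
  refine ⟨fun h => ?_, fun h => ?_⟩
  · rw [max_eq_right h] at hle
    exact le_antisymm hle (ce_le_ce_applyMorph_wcompl hne w)
  · rwa [max_eq_left h.le] at hle
end

section
/- Let a ∈ {0,1} and n ≥ 1, and let ā denote the complement of a. In the word μ^n(a ā) (which has length 2^{n+1}), the only positions at which a factor equal to an n-block (that is, equal to μ^n(0) or μ^n(1)) occurs are positions 0 and 2^n. -/
theorem mu_cons (b : Bool) (w : List Bool) : mu (b :: w) = b :: (!b) :: mu w := by
  cases b <;> simp [mu, applyMorph]

theorem length_mu (w : List Bool) : (mu w).length = 2 * w.length := by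
  induction w with
  | nil => rfl
  | cons b w ih => simp only [mu_cons, List.length_cons, ih]; omega

theorem length_iterate_mu (n : ℕ) (w : List Bool) :
    (mu^[n] w).length = 2 ^ n * w.length := by
  induction n with
  | zero => simp
  | succ n ih => rw [Function.iterate_succ_apply', length_mu, ih, pow_succ]; ring

theorem getElem?_mu_two_mul (w : List Bool) (k : ℕ) : (mu w)[2 * k]? = w[k]? := by
  induction w generalizing k with
  | nil => simp [mu, applyMorph]
  | cons b w ih =>
    cases k with
    | zero => simp [mu_cons]
    | succ k => simp [mu_cons, Nat.mul_succ, ih]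

theorem getElem?_mu_two_mul_add_one (w : List Bool) (k : ℕ) :
    (mu w)[2 * k + 1]? = w[k]?.map (!·) := by
  induction w generalizing k with
  | nil => simp [mu, applyMorph]
  | cons b w ih =>
    cases k with
    | zero => simp [mu_cons]
    | succ k => simp [mu_cons, Nat.mul_succ, ih]

theorem getElem?_iterate_mu_zero (n : ℕ) (b : Bool) : (mu^[n] [b])[0]? = some b := by
  induction n with
  | zero => rfl
  | succ n ih =>
    rw [Function.iterate_succ_apply', ← ih]
    exact getElem?_mu_two_mul _ 0

theorem occursAt_iff_getElem? (x w : List Bool) (i : ℕ) :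
    OccursAt x w i ↔ i + x.length ≤ w.length ∧ ∀ k < x.length, w[i + k]? = x[k]? := by
  refine and_congr_right fun h => ⟨fun e k hk => ?_, fun e => List.ext_getElem? fun k => ?_⟩
  · have := congrArg (·[k]?) e
    simpa [List.getElem?_take, hk] using this
  · by_cases hk : k < x.length
    · simpa [List.getElem?_take, hk] using e k hk
    · rw [List.getElem?_take, if_neg hk, List.getElem?_eq_none (not_lt.1 hk)]

theorem occursAt_mu_two_mul (x w : List Bool) (j : ℕ) :
    OccursAt (mu x) (mu w) (2 * j) ↔ OccursAt x w j := by
  simp only [occursAt_iff_getElem?, length_mu]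
  refine and_congr (by omega) ⟨fun e k hk => ?_, fun e k hk => ?_⟩
  · rw [← getElem?_mu_two_mul, ← getElem?_mu_two_mul x, mul_add]
    exact e (2 * k) (by omega)
  · obtain ⟨l, rfl | rfl⟩ := Nat.even_or_odd' k
    · rw [← mul_add, getElem?_mu_two_mul, getElem?_mu_two_mul]
      exact e l (by omega)
    · rw [← add_assoc, ← mul_add, getElem?_mu_two_mul_add_one, getElem?_mu_two_mul_add_one,
        e l (by omega)]

/-- A block of order at least two has equal letters at positions 1 and 2, so it cannot occur at an
odd position of an image under `mu`. -/
theorem not_occursAt_mu_odd (n : ℕ) (b : Bool) (w : List Bool) (j : ℕ) :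
    ¬ OccursAt (mu^[n + 2] [b]) (mu w) (2 * j + 1) := by
  rw [occursAt_iff_getElem?]
  rintro ⟨-, e⟩
  have hlen : 4 ≤ (mu^[n + 2] [b]).length := by
    rw [length_iterate_mu, pow_add]
    have := Nat.one_le_two_pow (n := n)
    simp only [List.length_singleton]
    omega
  have e1 := e 1 (by omega)
  have e2 := e 2 (by omega)
  have h1 : (mu^[n + 2] [b])[1]? = some (!b) := by
    rw [Function.iterate_succ_apply', getElem?_mu_two_mul_add_one _ 0,
      getElem?_iterate_mu_zero, Option.map_some]
  have h2 : (mu^[n + 2] [b])[2]? = some (!b) := by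
    rw [Function.iterate_succ_apply', getElem?_mu_two_mul _ 1, Function.iterate_succ_apply',
      getElem?_mu_two_mul_add_one _ 0, getElem?_iterate_mu_zero, Option.map_some]
  rw [h1, show 2 * j + 1 + 1 = 2 * (j + 1) by ring, getElem?_mu_two_mul] at e1
  rw [h2, show 2 * j + 1 + 2 = 2 * (j + 1) + 1 by ring, getElem?_mu_two_mul_add_one, e1] at e2
  simp at e2

/-- in the word `μⁿ(a ā)` (with `n ≥ 1`), an `n`-block
(`μⁿ(0)` or `μⁿ(1)`) occurs exactly at the positions `0` and `2ⁿ`. -/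
theorem stmt3 (a : Bool) (n : ℕ) (hn : 1 ≤ n) (i : ℕ) :
    (∃ b : Bool, OccursAt (mu^[n] [b]) (mu^[n] [a, !a]) i) ↔ (i = 0 ∨ i = 2 ^ n) := by
  induction n, hn using Nat.le_induction generalizing i with
  | base =>
    by_cases hi : i ≤ 2
    · interval_cases i <;> cases a <;> simp [OccursAt, mu, applyMorph]
    · refine iff_of_false ?_ (by omega)
      rintro ⟨b, h, -⟩
      simp only [length_iterate_mu, List.length_cons, List.length_nil] at h
      omega
  | succ n hn ih =>
    obtain ⟨j, rfl | rfl⟩ := Nat.even_or_odd' i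
    · simp only [Function.iterate_succ_apply', occursAt_mu_two_mul, ih, pow_succ]
      omega
    · obtain ⟨m, rfl⟩ := Nat.exists_eq_add_of_le' hn
      refine iff_of_false ?_ (by rw [pow_succ]; omega)
      rintro ⟨b, h⟩
      rw [Function.iterate_succ_apply' mu (m + 1) [a, !a]] at h
      exact not_occursAt_mu_odd m b _ j h
end

section
/- Let k ≥ 1 and let u be a finite binary word with |u| > k that begins with a k-prefix and ends with a k-prefix (the two k-prefixes need not be the same one). Then 2|u| ≥ 3k. Moreover, if such a word u exists with 2|u| = 3k, then k is a power of 2; conversely, for every k ≥ 2 that is a power of 2 there exists such a word u with 2|u| = 3k. -/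
theorem tm_zero : tm 0 = false := by simp [tm]

theorem tm_one : tm 1 = true := by
  simpa [tm_zero] using tm_two_mul_add_one 0

theorem tm_two_pow (m : ℕ) : tm (2 ^ m) = true := by
  induction m with
  | zero => exact tm_one
  | succ m ih => rw [pow_succ', tm_two_mul, ih]

theorem tm_two_pow_add (m i : ℕ) (hi : i < 2 ^ m) : tm (2 ^ m + i) = !tm i := by
  induction m generalizing i with
  | zero =>
    obtain rfl : i = 0 := by simpa using hi
    simp [tm_zero, tm_one]
  | succ m ih =>
    rw [pow_succ'] at hi ⊢
    obtain ⟨j, rfl | rfl⟩ := Nat.even_or_odd' i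
    · rw [← mul_add, tm_two_mul, tm_two_mul, ih j (by omega)]
    · rw [← add_assoc, ← mul_add, tm_two_mul_add_one, tm_two_mul_add_one, ih j (by omega)]

/-- A shift `p` under which the first `p` letters of the Thue–Morse word are all kept or all
complemented is a power of 2. -/
theorem eq_two_pow_of_tm_shift (p : ℕ) (hp : 1 ≤ p) (c : Bool)
    (h : ∀ i < p, tm (i + p) = (tm i ^^ c)) : ∃ m, p = 2 ^ m := by
  induction p using Nat.strong_induction_on with
  | _ p ih =>
    obtain ⟨q, rfl | rfl⟩ := Nat.even_or_odd' p
    · obtain ⟨m, hm⟩ := ih q (by omega) (by omega) fun i hi => by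
        have := h (2 * i) (by omega)
        rwa [← mul_add, tm_two_mul, tm_two_mul] at this
      exact ⟨m + 1, by rw [hm, pow_succ']⟩
    · have const (j : ℕ) (hj : j < q) : tm (j + q) = tm (j + q + 1) := by
        have h0 := h (2 * j) (by omega)
        have h1 := h (2 * j + 1) (by omega)
        rw [show 2 * j + (2 * q + 1) = 2 * (j + q) + 1 by ring, tm_two_mul_add_one,
          tm_two_mul] at h0
        rw [show 2 * j + 1 + (2 * q + 1) = 2 * (j + q + 1) by ring, tm_two_mul_add_one,
          tm_two_mul] at h1
        rw [h1, ← Bool.not_not (tm (j + q)), h0]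
        simp
      have ne (r : ℕ) : tm (2 * r) ≠ tm (2 * r + 1) := by
        rw [tm_two_mul, tm_two_mul_add_one]
        simp
      obtain rfl | rfl | hq : q = 0 ∨ q = 1 ∨ 2 ≤ q := by omega
      · exact ⟨0, rfl⟩
      · have h1 := h 1 (by omega)
        have h2 := h 2 (by omega)
        have t2 := tm_two_mul 1
        have t4 := tm_two_mul 2
        have t5 := tm_two_mul_add_one 2
        norm_num [tm_one] at h1 h2 t2 t4 t5
        simp [t2, t4, t5] at h1 h2
        simp [h1] at h2
      · obtain ⟨r, rfl | rfl⟩ := Nat.even_or_odd' q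
        · exact absurd (by simpa using const 0 (by omega)) (ne r)
        · refine absurd ?_ (ne (r + 1))
          convert const 1 (by omega) using 2 <;> ring

theorem le_of_tm_shift (p n : ℕ) (hp : 1 ≤ p) (c : Bool)
    (h : ∀ i < n, tm (i + p) = (tm i ^^ c)) : n ≤ p := by
  by_contra! hn
  obtain ⟨m, rfl⟩ := eq_two_pow_of_tm_shift p hp c fun i hi => h i (by omega)
  have h0 := h 0 (by omega)
  have h1 := h _ hn
  rw [zero_add, tm_zero, tm_two_pow] at h0
  rw [← two_mul, tm_two_mul, tm_two_pow] at h1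
  cases c <;> simp at h0 h1

theorem kPrefix_iff (k : ℕ) (s : List Bool) :
    kPrefix k s ↔ ∃ c, s = (List.range k).map fun i => tm i ^^ c := by
  rw [Bool.exists_bool]
  simp [kPrefix, tmFactor, wcompl, Function.comp_def]

theorem exists_tm_shift (k : ℕ) (u : List Bool)
    (hs : ∃ s, kPrefix k s ∧ s <+: u) (hs' : ∃ s', kPrefix k s' ∧ s' <:+ u) :
    ∃ c, ∀ i < k - (u.length - k), tm (i + (u.length - k)) = (tm i ^^ c) := by
  simp only [kPrefix_iff] at hs hs'
  obtain ⟨_, ⟨c, rfl⟩, r, hr⟩ := hs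
  obtain ⟨_, ⟨c', rfl⟩, r', hr'⟩ := hs'
  have hlen : u.length - k = r'.length := by simp [← hr']
  rw [hlen]
  refine ⟨c' ^^ c, fun i hi => ?_⟩
  have key := congrArg (·[i + r'.length]?) (hr.trans hr'.symm)
  rw [List.getElem?_append_left (by simp; omega), List.getElem?_append_right (by omega)] at key
  rw [List.getElem?_map, List.getElem?_map, List.getElem?_range (by omega),
    List.getElem?_range (by omega)] at key
  simp only [Option.map_some, Option.some.injEq, Nat.add_sub_cancel] at key
  rw [← Bool.xor_assoc, ← key]
  simp

theorem tmFactor_two_pow_succ (m : ℕ) :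
    tmFactor 0 (2 ^ (m + 1)) = tmFactor 0 (2 ^ m) ++ wcompl (tmFactor 0 (2 ^ m)) := by
  rw [pow_succ, mul_two]
  simp only [tmFactor, wcompl, List.range_add, List.map_append, List.map_map,
    List.append_cancel_left_eq, List.map_inj_left, List.mem_range, Function.comp_apply, zero_add]
  exact fun i hi => tm_two_pow_add m i hi

/-- if `k ≥ 1` and `u` is a binary word with `|u| > k` beginning
with a `k`-prefix and ending with a `k`-prefix, then `2|u| ≥ 3k`; a word `u`
with equality exists only if `k` is a power of 2, and for every power of 2
`k ≥ 2` such a word with equality exists. -/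
theorem stmt5 (k : ℕ) (hk : 1 ≤ k) :
    (∀ u : List Bool, k < u.length →
      (∃ s, kPrefix k s ∧ s <+: u) → (∃ s', kPrefix k s' ∧ s' <:+ u) →
      3 * k ≤ 2 * u.length) ∧
    ((∃ u : List Bool, k < u.length ∧ (∃ s, kPrefix k s ∧ s <+: u) ∧
        (∃ s', kPrefix k s' ∧ s' <:+ u) ∧ 2 * u.length = 3 * k) →
      ∃ m : ℕ, k = 2 ^ m) ∧
    (2 ≤ k → (∃ m : ℕ, k = 2 ^ m) →
      ∃ u : List Bool, k < u.length ∧ (∃ s, kPrefix k s ∧ s <+: u) ∧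
        (∃ s', kPrefix k s' ∧ s' <:+ u) ∧ 2 * u.length = 3 * k) := by
  refine ⟨fun u hu hs hs' => ?_, ?_, ?_⟩
  · obtain ⟨c, hc⟩ := exists_tm_shift k u hs hs'
    have := le_of_tm_shift _ _ (by omega) c hc
    omega
  · rintro ⟨u, hu, hs, hs', hlen⟩
    obtain ⟨c, hc⟩ := exists_tm_shift k u hs hs'
    obtain ⟨m, hm⟩ := eq_two_pow_of_tm_shift (u.length - k) (by omega) c
      fun i hi => hc i (by omega)
    exact ⟨m + 1, by rw [pow_succ]; omega⟩
  · rintro h2 ⟨_ | m, rfl⟩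
    · norm_num at h2
    · refine ⟨tmFactor 0 (2 ^ m) ++ wcompl (tmFactor 0 (2 ^ (m + 1))), ?_,
        ⟨_, .inl rfl, ?_⟩, ⟨_, .inr rfl, List.suffix_append _ _⟩, ?_⟩
      · simp [tmFactor, wcompl]
      · rw [tmFactor_two_pow_succ, List.prefix_append_right_inj]
        simp [wcompl]
      · simp [tmFactor, wcompl, pow_succ]
        ring
end

section
/- Suppose k ≥ 1 is not a power of 2. Then the concatenation of any two k-prefixes does not contain a k-prefix as an internal factor; that is, if s and s′ are each equal to t[0..k−1] or its complement, then no factor of s s′ that is neither a prefix nor a suffix of s s′ equals t[0..k−1] or its complement. -/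
/-- The factors of length `m` of the Thue–Morse word at positions `0` and `i` agree
up to complement. -/
def PrefixRecursAt (i m : ℕ) : Prop := ∃ a : Bool, ∀ j < m, tm (i + j) = (a ^^ tm j)

theorem PrefixRecursAt.half {i m : ℕ} (h : PrefixRecursAt (2 * i) (2 * m)) :
    PrefixRecursAt i m := by
  obtain ⟨a, h⟩ := h
  refine ⟨a, fun j hj => ?_⟩
  simpa only [← mul_add, tm_two_mul] using h (2 * j) (by omega)

/-- At an odd position, no prefix of length at least `3` recurs: the equal letters
`t[1] = t[2]` would be aligned with an image of a letter under the morphism. -/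
theorem PrefixRecursAt.le_two_of_odd {i m : ℕ} (h : PrefixRecursAt i m) (hi : Odd i) :
    m ≤ 2 := by
  by_contra! hm
  obtain ⟨a, h⟩ := h
  obtain ⟨r, rfl⟩ := hi
  have h1 := h 1 (by omega)
  have h2 := h 2 (by omega)
  rw [show 2 * r + 1 + 1 = 2 * (r + 1) by ring, tm_two_mul] at h1
  rw [show 2 * r + 1 + 2 = 2 * (r + 1) + 1 by ring, tm_two_mul_add_one, h1] at h2
  have e : tm 1 = true ∧ tm 2 = true := by simp [tm]
  rw [e.1, e.2] at h2
  cases a <;> simp at h2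

theorem PrefixRecursAt.eq_one_of_odd {i m : ℕ} (hm : 0 < m) (h : PrefixRecursAt i m)
    (h' : PrefixRecursAt m i) (hi : Odd i) : i = 1 ∧ m = 1 := by
  have hm2 := h.le_two_of_odd hi
  obtain rfl | rfl : m = 1 ∨ m = 2 := by omega
  · have := h'.le_two_of_odd odd_one
    obtain ⟨r, rfl⟩ := hi
    omega
  · exfalso
    have e : tm 0 = false ∧ tm 1 = true ∧ tm 2 = true ∧ tm 3 = false ∧ tm 4 = true := by
      simp [tm]
    obtain ⟨e0, e1, e2, e3, e4⟩ := e
    rcases Nat.lt_or_ge i 3 with hi3 | hi3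
    · obtain ⟨r, rfl⟩ := hi
      obtain rfl : r = 0 := by omega
      obtain ⟨a, h⟩ := h
      have h0 := h 0 (by omega)
      have h1 := h 1 (by omega)
      cases a <;> simp_all
    · obtain ⟨b, h'⟩ := h'
      have h1 := h' 1 (by omega)
      have h2 := h' 2 (by omega)
      cases b <;> simp_all

theorem PrefixRecursAt.add_eq_two_pow {i m : ℕ} (hi : 0 < i) (hm : 0 < m)
    (h : PrefixRecursAt i m) (h' : PrefixRecursAt m i) : ∃ n : ℕ, i + m = 2 ^ n := by
  induction i using Nat.strong_induction_on generalizing m with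
  | _ i ih =>
    rcases Nat.even_or_odd' i with ⟨r, rfl | rfl⟩
    · rcases Nat.even_or_odd' m with ⟨q, rfl | rfl⟩
      · obtain ⟨n, hn⟩ := ih r (by omega) (by omega) (by omega) h.half h'.half
        exact ⟨n + 1, by rw [pow_succ]; omega⟩
      · have := h'.eq_one_of_odd hi h (odd_two_mul_add_one q)
        omega
    · obtain ⟨h1, rfl⟩ := h.eq_one_of_odd hm h' (odd_two_mul_add_one r)
      exact ⟨1, by omega⟩

theorem kPrefix.length_eq {k : ℕ} {s : List Bool} (h : kPrefix k s) : s.length = k := by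
  rcases h with rfl | rfl <;> simp [wcompl, tmFactor]

theorem kPrefix.exists_getElem? {k : ℕ} {s : List Bool} (h : kPrefix k s) :
    ∃ c : Bool, ∀ j < k, s[j]? = some (c ^^ tm j) := by
  rcases h with rfl | rfl
  · exact ⟨false, fun j hj => by simp [tmFactor, hj]⟩
  · exact ⟨true, fun j hj => by simp [tmFactor, wcompl, hj]⟩

/-- if `k ≥ 1` is not a power of 2, then the concatenation of any
two `k`-prefixes contains no `k`-prefix as an internal factor. -/
theorem stmt6 (k : ℕ) (hk : 1 ≤ k) (hnp : ¬ ∃ n : ℕ, k = 2 ^ n)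
    (s s' : List Bool) (hs : kPrefix k s) (hs' : kPrefix k s')
    (x : List Bool) (hx : x <:+: s ++ s')
    (hnotpre : ¬ x <+: s ++ s') (hnotsuf : ¬ x <:+ s ++ s') :
    ¬ kPrefix k x := by
  intro hkx
  obtain ⟨p, q, hpq⟩ := hx
  have hp : 0 < p.length := by
    refine List.length_pos_iff.2 ?_
    rintro rfl
    exact hnotpre ⟨q, hpq⟩
  have hq : 0 < q.length := by
    refine List.length_pos_iff.2 ?_
    rintro rfl
    exact hnotsuf ⟨p, by simpa using hpq⟩
  have ls := hs.length_eq
  have ls' := hs'.length_eq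
  have lx := hkx.length_eq
  have hlen : p.length + q.length = k := by
    have := congrArg List.length hpq
    simp only [List.length_append] at this
    omega
  obtain ⟨c, hc⟩ := hkx.exists_getElem?
  obtain ⟨d, hd⟩ := hs.exists_getElem?
  obtain ⟨e, he⟩ := hs'.exists_getElem?
  have key : ∀ j < k, x[j]? = (s ++ s')[p.length + j]? := by
    intro j hj
    rw [← hpq, List.append_assoc, List.getElem?_append_right (by omega),
      List.getElem?_append_left (by omega), Nat.add_sub_cancel_left]
  refine hnp (hlen ▸ PrefixRecursAt.add_eq_two_pow hp hq ⟨d ^^ c, fun j hj => ?_⟩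
    ⟨c ^^ e, fun j hj => ?_⟩)
  · have h := key j (by omega)
    rw [List.getElem?_append_left (by omega), hc j (by omega), hd _ (by omega),
      Option.some_inj] at h
    rw [Bool.xor_assoc, h, ← Bool.xor_assoc, Bool.xor_self, Bool.false_xor]
  · have h := key (q.length + j) (by omega)
    rw [List.getElem?_append_right (by omega), hc _ (by omega),
      show p.length + (q.length + j) - s.length = j by omega, he _ (by omega),
      Option.some_inj] at h
    rw [Bool.xor_assoc, ← h, ← Bool.xor_assoc, Bool.xor_self, Bool.false_xor]
end

section
/- Let p = m·2^n with m odd, m ≥ 5, and n ≥ 0. Then every factor u of the Thue–Morse word t such that p is a period of u satisfies |u| ≤ (m+3)·2^n. -/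
/-- The Thue–Morse word contains neither `000` nor `111`. -/
theorem tm_not_three_equal (j : ℕ) (h₁ : tm j = tm (j + 1)) (h₂ : tm (j + 1) = tm (j + 2)) :
    False := by
  obtain ⟨i, rfl | rfl⟩ := Nat.even_or_odd' j
  · simp [tm_two_mul, tm_two_mul_add_one] at h₁
  · rw [show 2 * i + 1 + 1 = 2 * (i + 1) by ring, show 2 * i + 1 + 2 = 2 * (i + 1) + 1 by ring,
      tm_two_mul, tm_two_mul_add_one] at h₂
    simp at h₂

/-- A length-four factor of the Thue–Morse word does not occur at both an even and an odd
position. -/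
theorem tm_no_match_four (i j : ℕ) (h : ∀ r < 4, tm (2 * i + r) = tm (2 * j + 1 + r)) :
    False := by
  have h0 := h 0 (by norm_num)
  have h1 := h 1 (by norm_num)
  have h2 := h 2 (by norm_num)
  have h3 := h 3 (by norm_num)
  rw [add_zero, add_zero, tm_two_mul, tm_two_mul_add_one] at h0
  rw [show 2 * j + 1 + 1 = 2 * (j + 1) by ring, tm_two_mul, tm_two_mul_add_one] at h1
  rw [show 2 * i + 2 = 2 * (i + 1) by ring, show 2 * j + 1 + 2 = 2 * (j + 1) + 1 by ring,
    tm_two_mul, tm_two_mul_add_one] at h2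
  rw [show 2 * i + 3 = 2 * (i + 1) + 1 by ring, show 2 * j + 1 + 3 = 2 * (j + 2) by ring,
    tm_two_mul, tm_two_mul_add_one] at h3
  apply tm_not_three_equal j
  · rw [← h1, h0, Bool.not_not]
  · rw [← h3, h2, Bool.not_not]

/-- A run of agreements between the Thue–Morse word and its shift by `m * 2 ^ n`, with `m` odd,
has length at most `3 * 2 ^ n`. -/
theorem tm_match_length_le {m : ℕ} (hm : Odd m) (n a k : ℕ)
    (h : ∀ i < k, tm (a + i) = tm (a + i + m * 2 ^ n)) : k ≤ 3 * 2 ^ n := by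
  induction n generalizing a k with
  | zero =>
    by_contra! hk
    obtain ⟨c, rfl⟩ := hm
    obtain ⟨b, rfl | rfl⟩ := Nat.even_or_odd' a
    · refine tm_no_match_four b (b + c) fun r hr => ?_
      rw [h r (by omega)]
      congr 1
      ring
    · refine tm_no_match_four (b + c + 1) b fun r hr => ?_
      rw [h r (by omega)]
      congr 1
      ring
  | succ n ih =>
    rcases Nat.eq_zero_or_pos k with rfl | hk
    · exact Nat.zero_le _
    have key : (a + k + 1) / 2 - a / 2 ≤ 3 * 2 ^ n := by
      refine ih (a / 2) _ fun i hi => ?_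
      by_cases hai : a ≤ 2 * (a / 2 + i)
      · have := h (2 * (a / 2 + i) - a) (by omega)
        rwa [show a + (2 * (a / 2 + i) - a) = 2 * (a / 2 + i) by omega,
          show 2 * (a / 2 + i) + m * 2 ^ (n + 1) = 2 * (a / 2 + i + m * 2 ^ n) by ring,
          tm_two_mul, tm_two_mul] at this
      · have := h 0 hk
        rw [show a + 0 = 2 * (a / 2 + i) + 1 by omega,
          show 2 * (a / 2 + i) + 1 + m * 2 ^ (n + 1) = 2 * (a / 2 + i + m * 2 ^ n) + 1 by ring,
          tm_two_mul_add_one, tm_two_mul_add_one] at this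
        exact Bool.not_inj this
    rw [pow_succ]
    omega

theorem tmFactor_getD {l k i : ℕ} (hi : i < k) : (tmFactor l k).getD i false = tm (l + i) := by
  simp [tmFactor, List.getD, hi]

/-- if `p = m·2ⁿ` with `m` odd and `m ≥ 5`, then every factor of
the Thue–Morse word with period `p` has length at most `(m+3)·2ⁿ`. -/
theorem stmt7 (m n p : ℕ) (hm : Odd m) (hm5 : 5 ≤ m) (hp : p = m * 2 ^ n)
    (u : List Bool) (hu : IsTMFactor u) (hper : HasPeriodW u p) :
    u.length ≤ (m + 3) * 2 ^ n := by
  obtain ⟨l, hl⟩ := hu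
  obtain ⟨-, hlen, h⟩ := hper
  have key : u.length - p ≤ 3 * 2 ^ n := by
    refine tm_match_length_le hm n l _ fun i hi => ?_
    have hi' := h i (by omega)
    rw [hl, tmFactor_getD (by omega), tmFactor_getD (by omega)] at hi'
    rw [hi', ← hp, add_assoc]
  rw [add_mul, ← hp]
  omega
end
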